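/- Let ι be a finite set, let v : ι → ℝ^N be a family of vectors, let n ≥ 1 be an integer, and define F : ℝ^N → ℝ by F(x) = e_n((⟨x, v_i⟩²)_{i∈ι}), where ⟨·,·⟩ is the standard inner product. Then for every x ∈ ℝ^N and every coordinate index k ∈ {1, …, N}, the second partial derivative of F with respect to x_k at x equals 2·Σ_{i∈ι} ((v_i)_k)² · e_{n−1}((⟨x, v_j⟩²)_{j∈ι∖{i}}) + 4·Σ over ordered pairs (i,j) with i ≠ j of (v_i)_k (v_j)_k · ⟨x, v_i⟩⟨x, v_j⟩ · e_{n−2}((⟨x, v_l⟩²)_{l∈ι∖{i,j}}). -/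

import Mathlib

open RealInnerProductSpace

/-- Elementary symmetric polynomial of the family `a` over the finite index set `s`,
with integer degree `n`: `e_0 = 1`, `e_n = 0` for `n < 0` or `n > |s|`. -/
def esymmZ {ι : Type*} (s : Finset ι) (a : ι → ℝ) (n : ℤ) : ℝ :=
  if 0 ≤ n then ∑ t ∈ s.powersetCard n.toNat, ∏ i ∈ t, a i else 0

lemma esymmZ_empty {ι : Type*} (a : ι → ℝ) (n : ℤ) :
    esymmZ ∅ a n = if n = 0 then 1 else 0 := by
  rcases lt_trichotomy n 0 with hn | rfl | hn
  · simp [esymmZ, not_le.2 hn, hn.ne]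
  · simp [esymmZ]
  · have hcard : (∅ : Finset ι).card < n.toNat := by simpa using hn
    simp [esymmZ, Finset.powersetCard_eq_empty.2 hcard, hn.ne']

/-- Pascal recursion for `esymmZ`, valid in every integer degree. -/
lemma esymmZ_insert {ι : Type*} [DecidableEq ι] {s : Finset ι} {i : ι} (hi : i ∉ s)
    (a : ι → ℝ) (n : ℤ) :
    esymmZ (insert i s) a n = esymmZ s a n + a i * esymmZ s a (n - 1) := by
  rcases lt_trichotomy n 0 with hn | rfl | hn
  · simp [esymmZ, not_le.2 hn, show ¬ (1 ≤ n) by lia]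
  · simp [esymmZ]
  · obtain ⟨m, rfl⟩ : ∃ m : ℕ, n = m + 1 := ⟨(n - 1).toNat, by lia⟩
    have hm : ((m : ℤ) + 1).toNat = m.succ := by lia
    have hmem : ∀ t ∈ s.powersetCard m, i ∉ t := fun t ht h =>
      hi ((Finset.mem_powersetCard.1 ht).1 h)
    have hdisj : Disjoint (s.powersetCard m.succ) ((s.powersetCard m).image (insert i)) := by
      refine Finset.disjoint_left.2 fun t ht ht' => ?_
      obtain ⟨u, -, rfl⟩ := Finset.mem_image.1 ht'
      exact hi ((Finset.mem_powersetCard.1 ht).1 (Finset.mem_insert_self i u))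
    have hinj : Set.InjOn (insert i) (s.powersetCard m : Set (Finset ι)) := fun t ht u hu h => by
      rw [← Finset.erase_insert (hmem t ht), ← Finset.erase_insert (hmem u hu), h]
    simp only [esymmZ, add_sub_cancel_right, Int.natCast_nonneg, if_true, Int.toNat_natCast, hm,
      show (0 : ℤ) ≤ m + 1 by lia]
    rw [Finset.powersetCard_succ_insert hi, Finset.sum_union hdisj, Finset.sum_image hinj,
      Finset.mul_sum]
    congr 1
    exact Finset.sum_congr rfl fun t ht => Finset.prod_insert (hmem t ht)

/-- Differentiating `esymmZ` in the `i`-th variable removes the index `i` and lowers the degree. -/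
lemma hasFDerivAt_esymmZ {ι E : Type*} [DecidableEq ι] [NormedAddCommGroup E] [NormedSpace ℝ E]
    {a : ι → E → ℝ} {a' : ι → E →L[ℝ] ℝ} {x : E} (s : Finset ι)
    (ha : ∀ i ∈ s, HasFDerivAt (a i) (a' i) x) (n : ℤ) :
    HasFDerivAt (fun y => esymmZ s (fun i => a i y) n)
      (∑ i ∈ s, esymmZ (s.erase i) (fun j => a j x) (n - 1) • a' i) x := by
  induction s using Finset.induction_on generalizing n with
  | empty =>
    simp only [esymmZ_empty _ n, Finset.sum_empty]
    exact hasFDerivAt_const _ x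
  | insert i s hi ih =>
    have ih' := ih fun j hj => ha j (Finset.mem_insert_of_mem hj)
    simp only [esymmZ_insert hi]
    refine ((ih' n).fun_add ((ha i (Finset.mem_insert_self i s)).fun_mul (ih' (n - 1)))).congr_fderiv ?_
    have herase : ∀ j ∈ s,
        esymmZ ((insert i s).erase j) (fun l => a l x) (n - 1) • a' j
          = esymmZ (s.erase j) (fun l => a l x) (n - 1) • a' j
            + a i x • esymmZ (s.erase j) (fun l => a l x) (n - 1 - 1) • a' j := by
      intro j hj
      have hij : i ≠ j := fun h => hi (h ▸ hj)
      rw [Finset.erase_insert_of_ne hij, esymmZ_insert fun h => hi (Finset.mem_of_mem_erase h),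
        add_smul, mul_smul]
    rw [Finset.sum_insert hi, Finset.erase_insert hi, Finset.sum_congr rfl herase,
      Finset.sum_add_distrib, ← Finset.smul_sum]
    abel

/-- For `F(x) = e_n((⟨x, v_i⟩²)_{i∈ι})` with `n ≥ 1`, the second partial derivative of `F`
in the `k`-th coordinate direction at `x` equals
`2·Σ_i ((v_i)_k)² e_{n−1}((⟨x, v_j⟩²)_{j≠i})
  + 4·Σ_{i≠j} (v_i)_k (v_j)_k ⟨x, v_i⟩⟨x, v_j⟩ e_{n−2}((⟨x, v_l⟩²)_{l∉{i,j}})`. -/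
theorem esymm_proj_second_partial_deriv {ι : Type*} [Fintype ι] [DecidableEq ι] {N : ℕ}
    (v : ι → EuclideanSpace ℝ (Fin N)) (n : ℤ) (hn : 1 ≤ n)
    (F : EuclideanSpace ℝ (Fin N) → ℝ)
    (hF : F = fun x => esymmZ Finset.univ (fun i => ⟪x, v i⟫ ^ 2) n) :
    ∀ (x : EuclideanSpace ℝ (Fin N)) (k : Fin N),
      fderiv ℝ (fun y => fderiv ℝ F y (EuclideanSpace.single k 1)) x
          (EuclideanSpace.single k 1)
        = 2 * ∑ i, (v i k) ^ 2 * esymmZ (Finset.univ.erase i) (fun j => ⟪x, v j⟫ ^ 2) (n - 1)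
          + 4 * ∑ i, ∑ j ∈ Finset.univ.erase i,
              v i k * v j k * ⟪x, v i⟫ * ⟪x, v j⟫
                * esymmZ ((Finset.univ.erase i).erase j) (fun l => ⟪x, v l⟫ ^ 2) (n - 2) := by
  intro x k
  have hinner (i : ι) (y : EuclideanSpace ℝ (Fin N)) :
      HasFDerivAt (fun z => ⟪z, v i⟫) (innerSL ℝ (v i)) y := by
    have h : (fun z => ⟪z, v i⟫) = innerSL ℝ (v i) := funext fun z => real_inner_comm (v i) z
    exact h ▸ (innerSL ℝ (v i)).hasFDerivAt
  have hsq (i : ι) (y : EuclideanSpace ℝ (Fin N)) :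
      HasFDerivAt (fun z => ⟪z, v i⟫ ^ 2) ((2 * ⟪y, v i⟫) • innerSL ℝ (v i)) y := by
    simpa using (hinner i y).pow 2
  have hcoord (i : ι) : innerSL ℝ (v i) (EuclideanSpace.single k 1) = v i k := by
    simp [EuclideanSpace.inner_single_right]
  have hfirst : (fun y => fderiv ℝ F y (EuclideanSpace.single k 1)) = fun y =>
      ∑ i, esymmZ (Finset.univ.erase i) (fun j => ⟪y, v j⟫ ^ 2) (n - 1)
        * (2 * v i k * ⟪y, v i⟫) := by
    funext y
    rw [hF, (hasFDerivAt_esymmZ Finset.univ (fun i _ => hsq i y) n).fderiv]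
    simp only [sum_apply, smul_apply, hcoord, smul_eq_mul]
    exact Finset.sum_congr rfl fun i _ => by ring
  have hsecond := HasFDerivAt.fun_sum (u := Finset.univ) fun i _ =>
    (hasFDerivAt_esymmZ (Finset.univ.erase i) (fun j _ => hsq j x) (n - 1)).fun_mul
      ((hinner i x).const_mul (2 * v i k))
  rw [hfirst, hsecond.fderiv]
  simp only [sum_apply, add_apply,
    smul_apply, hcoord, smul_eq_mul, Finset.sum_add_distrib, Finset.mul_sum,
    show n - 1 - 1 = n - 2 by ring]
  congr 1
  · exact Finset.sum_congr rfl fun i _ => by ring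
  · exact Finset.sum_congr rfl fun i _ => Finset.sum_congr rfl fun j _ => by ring
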